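/- Let f : A → A be a covering map of degree d with |d| > 1. Suppose there is an essential attracting set: an open connected set U ⊊ A whose closure in A is compact, which contains a loop that is not null-homotopic in A, and such that the closure in A of f(U) is contained in U. Then f is complete: for every integer n ≥ 1, the map fⁿ has exactly |dⁿ − 1| Nielsen classes of fixed points. -/

import Mathlib

open Set Filter Topology

noncomputable section

/-- The open annulus `A = S¹ × (0,1)`. -/
abbrev Ann : Type := Circle × (Set.Ioo (0:ℝ) 1)

/-- The universal cover `Ã = ℝ × (0,1)`. -/
abbrev AnnTil : Type := ℝ × (Set.Ioo (0:ℝ) 1)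

/-- The covering projection `π(x,y) = (exp(2πix), y)`. -/
def pr : AnnTil → Ann := fun z => (Circle.exp (2 * Real.pi * z.1), z.2)

/-- Translation by an integer in the first coordinate: `z + k`. -/
def tr (z : AnnTil) (k : ℤ) : AnnTil := (z.1 + k, z.2)

/-- `F` is a lift of `f`. -/
def IsLift (f : Ann → Ann) (F : AnnTil → AnnTil) : Prop :=
  Continuous F ∧ pr ∘ F = f ∘ pr

/-- `f` has degree `d`: some lift satisfies `F(z+1) = F(z) + d`. -/
def HasDegree (f : Ann → Ann) (d : ℤ) : Prop :=
  ∃ F : AnnTil → AnnTil, IsLift f F ∧ ∀ z, F (tr z 1) = tr (F z) d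

/-- A subset of the annulus is essential if it is not contained in any
connected, simply connected open subset. -/
def IsEssential (K : Set Ann) : Prop :=
  ¬ ∃ U : Set Ann, IsOpen U ∧ IsConnected U ∧ SimplyConnectedSpace U ∧ K ⊆ U

/-- Nielsen equivalence of fixed points `p`, `q` of `g`: there is a path `γ`
from `p` to `q` homotopic (rel endpoints) to `g ∘ γ`. -/
def NielsenEquiv (g : Ann → Ann) (p q : Ann) : Prop :=
  ∃ (hg : Continuous g) (hp : g p = p) (hq : g q = q) (γ : Path p q),
    γ.Homotopic ((γ.map hg).cast hp.symm hq.symm)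

/-- `g` has exactly `N` Nielsen classes of fixed points. -/
def HasExactlyNielsenClasses (g : Ann → Ann) (N : ℕ) : Prop :=
  ∃ S : Finset Ann, S.card = N ∧ (∀ p ∈ S, g p = p) ∧
    (∀ p ∈ S, ∀ q ∈ S, p ≠ q → ¬ NielsenEquiv g p q) ∧
    (∀ p, g p = p → ∃ q ∈ S, NielsenEquiv g p q)

/-- `Fill K`: the union of `K` with the connected components of its
complement whose closure is compact. -/
def Fill (K : Set Ann) : Set Ann :=
  K ∪ {x | x ∈ Kᶜ ∧ IsCompact (closure (connectedComponentIn Kᶜ x))}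

lemma cos_pos_stay {S : Set ℝ} (hS : IsPreconnected S) {h : ℝ → ℝ} (hc : ContinuousOn h S)
    (c : ℝ) (hpos : ∀ t ∈ S, 0 < Real.cos (h t - c)) {p q : ℝ} (hp : p ∈ S) (hq : q ∈ S)
    (h0 : |h p - c| < Real.pi / 2) : |h q - c| < Real.pi / 2 := by
  rw [abs_lt] at *
  by_contra hcon
  have himg : IsPreconnected (h '' S) := hS.image h hc
  have hord := himg.ordConnected
  have hmp : h p ∈ h '' S := mem_image_of_mem h hp
  have hmq : h q ∈ h '' S := mem_image_of_mem h hq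
  rcases lt_or_ge (h q - c) (Real.pi / 2) with h1 | h1
  · have h2 : h q - c ≤ -(Real.pi/2) := by
      by_contra h3; exact hcon ⟨by linarith, h1⟩
    obtain ⟨t, ht, hte⟩ := hord.out hmq hmp (show c - Real.pi/2 ∈ Icc (h q) (h p) from
      ⟨by linarith, by linarith⟩)
    have := hpos t ht
    rw [hte, show c - Real.pi/2 - c = -(Real.pi/2) by ring, Real.cos_neg, Real.cos_pi_div_two] at this
    exact lt_irrefl _ this
  · obtain ⟨t, ht, hte⟩ := hord.out hmp hmq (show c + Real.pi/2 ∈ Icc (h p) (h q) from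
      ⟨by linarith, by linarith⟩)
    have := hpos t ht
    rw [hte, show c + Real.pi/2 - c = (Real.pi/2) by ring, Real.cos_pi_div_two] at this
    exact lt_irrefl _ this

lemma half_of_cos_pos {x : ℝ} (h1 : |x| < Real.pi) (h2 : 0 < Real.cos x) : |x| < Real.pi / 2 := by
  by_contra h
  push Not at h
  have := Real.cos_nonpos_of_pi_div_two_le_of_le h (by linarith [Real.pi_pos])
  rw [Real.cos_abs] at this
  linarith

/-- moving from a half-turn window around `c` to the one around `c - π/2`. -/
lemma shift_window {x c : ℝ} (h1 : |x - c| < Real.pi / 2)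
    (h2 : 0 < Real.cos (x - (c - Real.pi/2))) : |x - (c - Real.pi/2)| < Real.pi/2 := by
  apply half_of_cos_pos _ h2
  rw [abs_lt] at *
  constructor <;> linarith [Real.pi_pos]

lemma miranda (W : ℝ × ℝ → ℂ) (hW : Continuous W) (hn : ∀ p, ‖W p‖ = 1) (N a b : ℝ)
    (hN : 0 ≤ N) (hab : a ≤ b)
    (hr : ∀ y ∈ Icc a b, 0 < (W (N, y)).re) (hl : ∀ y ∈ Icc a b, (W (-N, y)).re < 0)
    (ht : ∀ t ∈ Icc (-N) N, (W (t, b)).im < 0) (hb : ∀ t ∈ Icc (-N) N, 0 < (W (t, a)).im) :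
    False := by
  let f : C(ℝ × ℝ, Circle) := ⟨fun p => ⟨W p, mem_sphere_zero_iff_norm.2 (hn p)⟩, by fun_prop⟩
  obtain ⟨e₀, he⟩ := Circle.exp_surjective (f (N, b))
  obtain ⟨θ, ⟨-, hθ⟩, -⟩ := Circle.isCoveringMap_exp.existsUnique_continuousMap_lifts f (N, b) e₀ he
  have hWθ : ∀ p, W p = Complex.exp (θ p * Complex.I) := fun p => by
    have := congrArg (fun c : Circle => (c : ℂ)) (congrFun hθ p)
    simp only [Function.comp_apply, Circle.coe_exp] at this
    exact this.symm
  have hre : ∀ p, (W p).re = Real.cos (θ p) := fun p => by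
    rw [hWθ, Complex.exp_ofReal_mul_I_re]
  have him : ∀ p, (W p).im = Real.sin (θ p) := fun p => by
    rw [hWθ, Complex.exp_ofReal_mul_I_im]
  have hθc : Continuous θ := θ.continuous
  have hvert : ∀ x, Continuous fun y : ℝ => θ (x, y) := fun x => by fun_prop
  have hhor : ∀ y, Continuous fun x : ℝ => θ (x, y) := fun y => by fun_prop
  have ia : a ∈ Icc a b := ⟨le_rfl, hab⟩
  have ib : b ∈ Icc a b := ⟨hab, le_rfl⟩
  have iN : N ∈ Icc (-N) N := ⟨by linarith, le_rfl⟩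
  have iN' : -N ∈ Icc (-N) N := ⟨le_rfl, by linarith⟩
  -- normalise at the top right corner
  set c : ℝ := θ (N, b) - toIocMod Real.two_pi_pos (-Real.pi) (θ (N,b)) with hc
  have hcz : c = toIocDiv Real.two_pi_pos (-Real.pi) (θ (N,b)) * (2 * Real.pi) := by
    rw [hc, self_sub_toIocMod, zsmul_eq_mul]
  generalize toIocDiv Real.two_pi_pos (-Real.pi) (θ (N,b)) = m at hcz
  have hcos : ∀ x, Real.cos (x - c) = Real.cos x := fun x => by
    rw [hcz]; exact Real.cos_sub_int_mul_two_pi x m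
  have hsin : ∀ x, Real.sin (x - c) = Real.sin x := fun x => by
    rw [hcz]; exact Real.sin_sub_int_mul_two_pi x m
  have k1 : ∀ x, Real.cos (x - (c - Real.pi/2)) = - Real.sin x := fun x => by
    rw [show x - (c - Real.pi/2) = (x - c) + Real.pi/2 by ring, Real.cos_add_pi_div_two, hsin]
  have k2 : ∀ x, Real.cos (x - (c - Real.pi/2 - Real.pi/2)) = - Real.cos x := fun x => by
    rw [show x - (c - Real.pi/2 - Real.pi/2) = (x - c) + Real.pi by ring, Real.cos_add_pi, hcos]
  have k3 : ∀ x, Real.cos (x - (c - Real.pi/2 - Real.pi/2 - Real.pi/2)) = Real.sin x := fun x => by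
    rw [show x - (c - Real.pi/2 - Real.pi/2 - Real.pi/2) = (x - c) + Real.pi/2 + Real.pi by ring,
      Real.cos_add_pi, Real.cos_add_pi_div_two, hsin]; ring
  have s0 : |θ (N, b) - c| < Real.pi / 2 := by
    have h1 := hr b ib
    rw [hre, ← hcos] at h1
    have h2 := toIocMod_mem_Ioc Real.two_pi_pos (-Real.pi) (θ (N,b))
    have h3 : θ (N,b) - c = toIocMod Real.two_pi_pos (-Real.pi) (θ (N,b)) := by rw [hc]; ring
    rw [← h3] at h2
    have h4 : θ (N,b) - c ≠ Real.pi := fun h => by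
      rw [h, Real.cos_pi] at h1; linarith
    apply half_of_cos_pos _ h1
    rw [abs_lt]
    exact ⟨h2.1, lt_of_le_of_ne (by linarith [h2.2]) h4⟩
  have sR : |θ (N, a) - c| < Real.pi / 2 :=
    cos_pos_stay isPreconnected_Icc (hvert N).continuousOn c
      (fun y hy => by rw [hcos, ← hre]; exact hr y hy) ib ia s0
  have t0 : |θ (N, b) - (c - Real.pi/2)| < Real.pi/2 := shift_window s0 (by
    rw [k1, ← him]; linarith [ht N iN])
  have t1 : |θ (-N, b) - (c - Real.pi/2)| < Real.pi/2 :=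
    cos_pos_stay isPreconnected_Icc (hhor b).continuousOn _
      (fun t h => by rw [k1, ← him]; linarith [ht t h]) iN iN' t0
  have l0 := shift_window t1 (by rw [k2, ← hre]; linarith [hl b ib])
  have l1 : |θ (-N, a) - (c - Real.pi/2 - Real.pi/2)| < Real.pi/2 :=
    cos_pos_stay isPreconnected_Icc (hvert (-N)).continuousOn _
      (fun t h => by rw [k2, ← hre]; linarith [hl t h]) ib ia l0
  have b0 := shift_window l1 (by rw [k3, ← him]; linarith [hb (-N) iN'])
  have b1 : |θ (N, a) - (c - Real.pi/2 - Real.pi/2 - Real.pi/2)| < Real.pi/2 :=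
    cos_pos_stay isPreconnected_Icc (hhor a).continuousOn _
      (fun t h => by rw [k3, ← him]; linarith [hb t h]) iN' iN b0
  rw [abs_lt] at sR b1
  linarith [sR.1, b1.2]

/-- The strip as a subset of the complex plane. -/
def cc (z : AnnTil) : ℂ := ⟨z.1, z.2⟩

lemma cc_cont : Continuous cc := by
  have : cc = fun z : AnnTil => ((z.1 : ℝ) : ℂ) + ((z.2 : ℝ) : ℂ) * Complex.I := by
    funext z; apply Complex.ext <;> simp [cc]
  rw [this]; fun_prop

lemma cc_inj {z w : AnnTil} (h : cc z = cc w) : z = w := by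
  have h1 := congrArg Complex.re h
  have h2 := congrArg Complex.im h
  exact Prod.ext h1 (Subtype.ext h2)

lemma dist_le_cc (z w : AnnTil) : dist z w ≤ ‖cc z - cc w‖ := by
  rw [Prod.dist_eq]
  apply max_le
  · have := Complex.abs_re_le_norm (cc z - cc w)
    simpa [cc, Real.dist_eq] using this
  · have := Complex.abs_im_le_norm (cc z - cc w)
    simpa [cc, Subtype.dist_eq, Real.dist_eq] using this

/-- `L` is a normalised determination, on `Q`, of the angle of `w - z`. -/
structure Good (Q : Set AnnTil) (s : ℝ) (z : AnnTil) (L : AnnTil → ℝ) (R : ℝ) : Prop where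
  cont : ContinuousOn L Q
  eq : ∀ w ∈ Q, cc w - cc z = ‖cc w - cc z‖ * Complex.exp (L w * Complex.I)
  right : ∀ w ∈ Q, z.1 + R ≤ w.1 → |L w| < Real.pi / 2
  left : ∀ w ∈ Q, w.1 ≤ z.1 - R → |L w - s * Real.pi| < Real.pi / 2

lemma Good.mono {Q : Set AnnTil} {s : ℝ} {z : AnnTil} {L : AnnTil → ℝ} {R R' : ℝ}
    (h : Good Q s z L R) (hR : R ≤ R') : Good Q s z L R' :=
  ⟨h.cont, h.eq, fun w hw h1 => h.right w hw (by linarith),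
    fun w hw h1 => h.left w hw (by linarith)⟩

lemma cos_shift {s : ℝ} (hs : s = 1 ∨ s = -1) (x : ℝ) :
    Real.cos (x - s * Real.pi) = - Real.cos x := by
  rcases hs with rfl | rfl
  · rw [one_mul, Real.cos_sub_pi]
  · rw [neg_one_mul, sub_neg_eq_add, Real.cos_add_pi]

lemma re_eq {z w : AnnTil} {x : ℝ} (h : cc w - cc z = ‖cc w - cc z‖ * Complex.exp (x * Complex.I)) :
    w.1 - z.1 = ‖cc w - cc z‖ * Real.cos x := by
  have := congrArg Complex.re h
  rw [Complex.re_ofReal_mul, Complex.exp_ofReal_mul_I_re] at this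
  simpa [cc] using this

lemma Good.move {Q : Set AnnTil} {s : ℝ} (hs : s = 1 ∨ s = -1) {z : AnnTil} {L : AnnTil → ℝ}
    {R : ℝ} (hR : 0 ≤ R)
    (h : Good Q s z L R) (z' : AnnTil) (hz : ∀ w ∈ Q, ‖cc z' - cc z‖ < ‖cc w - cc z‖)
    (h1 : ‖cc z' - cc z‖ ≤ 1) :
    Good Q s z' (fun w => L w + Complex.arg ((cc w - cc z') / (cc w - cc z))) (R + 2) := by
  have hne : ∀ w ∈ Q, cc w - cc z ≠ 0 := fun w hw h0 => by
    have := hz w hw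
    rw [h0, norm_zero] at this
    exact absurd this (not_lt.2 (norm_nonneg _))
  have hre : ∀ w ∈ Q, 0 < ((cc w - cc z') / (cc w - cc z)).re := fun w hw => by
    have e : (cc w - cc z') / (cc w - cc z) = 1 - (cc z' - cc z) / (cc w - cc z) := by
      field_simp [hne w hw]; ring
    rw [e, Complex.sub_re, Complex.one_re]
    have a1 := Complex.re_le_norm ((cc z' - cc z) / (cc w - cc z))
    rw [norm_div] at a1
    have a2 : ‖cc z' - cc z‖ / ‖cc w - cc z‖ < 1 :=
      (div_lt_one (norm_pos_iff.2 (hne w hw))).2 (hz w hw)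
    linarith
  have hne' : ∀ w ∈ Q, cc w - cc z' ≠ 0 := fun w hw h0 => by
    have := hre w hw
    rw [h0, zero_div] at this
    simp at this
  have harg : ∀ w ∈ Q, |Complex.arg ((cc w - cc z') / (cc w - cc z))| < Real.pi / 2 := fun w hw =>
    Complex.abs_arg_lt_pi_div_two_iff.2 (Or.inl (hre w hw))
  have heq : ∀ w ∈ Q, cc w - cc z' = ‖cc w - cc z'‖ * Complex.exp
      (((L w + Complex.arg ((cc w - cc z') / (cc w - cc z)) : ℝ) : ℂ) * Complex.I) := fun w hw => by
    have e1 := h.eq w hw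
    have e2 := Complex.norm_mul_exp_arg_mul_I ((cc w - cc z') / (cc w - cc z))
    push_cast
    rw [add_mul, Complex.exp_add]
    have e3 : (cc w - cc z') = (cc w - cc z) * ((cc w - cc z') / (cc w - cc z)) := by
      field_simp [hne w hw]
    have hn : (‖cc w - cc z‖ : ℂ) ≠ 0 := by
      exact_mod_cast norm_ne_zero_iff.2 (hne w hw)
    calc cc w - cc z' = (cc w - cc z) * ((cc w - cc z') / (cc w - cc z)) := e3
      _ = (‖cc w - cc z‖ * Complex.exp (L w * Complex.I)) *
          (‖(cc w - cc z') / (cc w - cc z)‖ *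
            Complex.exp ((Complex.arg ((cc w - cc z') / (cc w - cc z)) : ℂ) * Complex.I)) := by
          rw [e2, ← e1]
      _ = _ := by
          rw [norm_div]; push_cast; field_simp
  have hx : |z'.1 - z.1| ≤ 1 := by
    have := Complex.abs_re_le_norm (cc z' - cc z)
    simp only [cc, Complex.sub_re] at this
    exact this.trans h1
  rw [abs_le] at hx
  refine ⟨?_, heq, ?_, ?_⟩
  · apply h.cont.add
    intro w hw
    apply ContinuousAt.continuousWithinAt
    refine ContinuousAt.comp (g := Complex.arg)
      (Complex.continuousAt_arg (Or.inl (hre w hw))) ?_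
    exact (cc_cont.continuousAt.sub continuousAt_const).div
      (cc_cont.continuousAt.sub continuousAt_const) (hne w hw)
  · intro w hw hw1
    have b1 := h.right w hw (by linarith)
    have b2 := harg w hw
    apply half_of_cos_pos
    · rw [abs_lt] at *; constructor <;> linarith
    · have := re_eq (heq w hw)
      refine pos_of_mul_pos_right (?_ : 0 < ‖cc w - cc z'‖ * _) (norm_nonneg _)
      rw [← this]; linarith
  · intro w hw hw1
    have b1 := h.left w hw (by linarith)
    have b2 := harg w hw
    apply half_of_cos_pos
    · rw [abs_lt] at *; constructor <;> linarith
    · have := re_eq (heq w hw)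
      rw [cos_shift hs]
      refine pos_of_mul_pos_right (b := - Real.cos _) (?_ : 0 < ‖cc w - cc z'‖ * _) (norm_nonneg _)
      rw [mul_neg, ← this]; linarith

/-- Every point of `Q` lies in a connected part of `Q` unbounded in both directions. -/
def Conn (Q : Set AnnTil) : Prop := ∀ w ∈ Q, ∃ C ⊆ Q, IsPreconnected C ∧ w ∈ C ∧
  (∀ M : ℝ, ∃ w' ∈ C, M ≤ w'.1) ∧ (∀ M : ℝ, ∃ w' ∈ C, w'.1 ≤ M)

lemma isDiscrete_mul_int : IsDiscrete (range (fun n : ℤ => (n : ℝ))) := by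
  exact Int.isClosedEmbedding_coe_real.isEmbedding.isInducing.isDiscrete_range

lemma Good.diff {Q : Set AnnTil} (hQ : Conn Q) {s s' : ℝ} {z : AnnTil} {L L' : AnnTil → ℝ}
    {R R' : ℝ} (h : Good Q s z L R) (h' : Good Q s' z L' R') (hz : z ∉ Q) :
    ∀ w ∈ Q, ∃ C ⊆ Q, w ∈ C ∧ (∀ w' ∈ C, L w' = L' w') ∧ (∀ M : ℝ, ∃ w' ∈ C, w'.1 ≤ M) := by
  intro w hw
  obtain ⟨C, hCQ, hC, hwC, hr, hl⟩ := hQ w hw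
  refine ⟨C, hCQ, hwC, ?_, hl⟩
  obtain ⟨v, hvC, hv⟩ := hr (z.1 + max R R')
  have hpi := Real.pi_pos
  have hZval : ∀ u ∈ Q, ∃ n : ℤ, (n : ℝ) = (L u - L' u) / (2 * Real.pi) := fun u hu => by
    have hne : (‖cc u - cc z‖ : ℂ) ≠ 0 := by
      have : cc u - cc z ≠ 0 := fun h0 => hz (cc_inj (sub_eq_zero.1 h0) ▸ hu)
      exact_mod_cast norm_ne_zero_iff.2 this
    have e := mul_left_cancel₀ hne ((h.eq u hu).symm.trans (h'.eq u hu))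
    obtain ⟨n, hn⟩ := Complex.exp_eq_exp_iff_exists_int.1 e
    refine ⟨n, ?_⟩
    have := congrArg Complex.im hn
    simp at this
    rw [this]; field_simp; ring
  have hconst := fun x (hx : x ∈ C) => hC.constant_of_mapsTo isDiscrete_mul_int
    (f := fun u => (L u - L' u) / (2 * Real.pi))
    (((h.cont.mono hCQ).sub (h'.cont.mono hCQ)).div_const _)
    (fun u hu => by obtain ⟨n, hn⟩ := hZval u (hCQ hu); exact ⟨n, hn⟩) hx hvC
  have hv0 : L v - L' v = 0 := by
    obtain ⟨n, hn⟩ := hZval v (hCQ hvC)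
    have a1 := h.right v (hCQ hvC) (by linarith [le_max_left R R'])
    have a2 := h'.right v (hCQ hvC) (by linarith [le_max_right R R'])
    have e : L v - L' v = n * (2 * Real.pi) := by rw [hn]; field_simp
    rw [abs_lt] at a1 a2
    have c1 : (n : ℝ) < 1 := by
      by_contra hc; push Not at hc; nlinarith
    have c2 : (-1 : ℝ) < n := by
      by_contra hc; push Not at hc; nlinarith
    have c3 : n < 1 := by exact_mod_cast c1
    have c4 : -1 < n := by exact_mod_cast c2
    have : n = 0 := by omega
    rw [e, this]; simp
  intro w' hw'
  have := hconst w' hw'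
  simp only [hv0, zero_div] at this
  rcases div_eq_zero_iff.1 this with h1 | h1
  · linarith
  · linarith

lemma Good.unique {Q : Set AnnTil} (hQ : Conn Q) {s s' : ℝ} {z : AnnTil} {L L' : AnnTil → ℝ}
    {R R' : ℝ} (h : Good Q s z L R) (h' : Good Q s' z L' R') (hz : z ∉ Q) :
    ∀ w ∈ Q, L w = L' w := fun w hw => by
  obtain ⟨C, -, hwC, hC, -⟩ := h.diff hQ h' hz w hw
  exact hC w hwC

lemma Good.disj {Q : Set AnnTil} (hQ : Conn Q) (hne : Q.Nonempty) {z : AnnTil} {L L' : AnnTil → ℝ}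
    {R R' : ℝ} (h : Good Q (-1) z L R) (h' : Good Q 1 z L' R') (hz : z ∉ Q) : False := by
  obtain ⟨w, hw⟩ := hne
  obtain ⟨C, hCQ, -, hC, hl⟩ := h.diff hQ h' hz w hw
  obtain ⟨v, hvC, hv⟩ := hl (z.1 - max R R')
  have a1 := h.left v (hCQ hvC) (by linarith [le_max_left R R'])
  have a2 := h'.left v (hCQ hvC) (by linarith [le_max_right R R'])
  rw [hC v hvC] at a1
  rw [abs_lt] at a1 a2
  linarith [Real.pi_pos, a1.2, a2.1]

lemma good_top {Q : Set AnnTil} {z : AnnTil} (h : ∀ w ∈ Q, (w.2 : ℝ) < z.2) :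
    Good Q (-1) z (fun w => Complex.arg (cc w - cc z)) 1 := by
  have him : ∀ w ∈ Q, (cc w - cc z).im < 0 := fun w hw => by
    simp only [cc, Complex.sub_im]; linarith [h w hw]
  refine ⟨?_, fun w hw => (Complex.norm_mul_exp_arg_mul_I _).symm, ?_, ?_⟩
  · intro w hw
    apply ContinuousAt.continuousWithinAt
    exact ContinuousAt.comp (g := Complex.arg)
      (Complex.continuousAt_arg (Or.inr (him w hw).ne))
      (cc_cont.continuousAt.sub continuousAt_const)
  · intro w hw h1
    apply Complex.abs_arg_lt_pi_div_two_iff.2 (Or.inl _)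
    simp only [cc, Complex.sub_re]; linarith
  · intro w hw h1
    have hre : (cc w - cc z).re < 0 := by simp only [cc, Complex.sub_re]; linarith
    have a1 := Complex.arg_neg_iff.2 (him w hw)
    have a2 := Complex.neg_pi_lt_arg (cc w - cc z)
    have a3 : ¬ |Complex.arg (cc w - cc z)| ≤ Real.pi / 2 := fun h =>
      absurd (Complex.abs_arg_le_pi_div_two_iff.1 h) (not_le.2 hre)
    rw [abs_of_neg a1] at a3
    rw [abs_lt]; constructor <;> linarith [Real.pi_pos]

lemma good_bot {Q : Set AnnTil} {z : AnnTil} (h : ∀ w ∈ Q, (z.2 : ℝ) < w.2) :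
    Good Q 1 z (fun w => Complex.arg (cc w - cc z)) 1 := by
  have him : ∀ w ∈ Q, 0 < (cc w - cc z).im := fun w hw => by
    simp only [cc, Complex.sub_im]; linarith [h w hw]
  refine ⟨?_, fun w hw => (Complex.norm_mul_exp_arg_mul_I _).symm, ?_, ?_⟩
  · intro w hw
    apply ContinuousAt.continuousWithinAt
    exact ContinuousAt.comp (g := Complex.arg)
      (Complex.continuousAt_arg (Or.inr (him w hw).ne'))
      (cc_cont.continuousAt.sub continuousAt_const)
  · intro w hw h1
    apply Complex.abs_arg_lt_pi_div_two_iff.2 (Or.inl _)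
    simp only [cc, Complex.sub_re]; linarith
  · intro w hw h1
    have hre : (cc w - cc z).re < 0 := by simp only [cc, Complex.sub_re]; linarith
    have a1 := Complex.arg_nonneg_iff.2 (him w hw).le
    have a2 := Complex.arg_le_pi (cc w - cc z)
    have a3 : ¬ |Complex.arg (cc w - cc z)| ≤ Real.pi / 2 := fun h =>
      absurd (Complex.abs_arg_le_pi_div_two_iff.1 h) (not_le.2 hre)
    rw [abs_of_nonneg a1] at a3
    rw [abs_lt]; constructor <;> linarith [Real.pi_pos]

lemma tr_cont (k : ℤ) : Continuous fun z => tr z k := by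
  unfold tr; fun_prop

lemma tr_tr (z : AnnTil) (k l : ℤ) : tr (tr z k) l = tr z (k + l) := by
  simp only [tr]; push_cast; rw [add_assoc]

lemma tr_zero (z : AnnTil) : tr z 0 = z := by simp [tr]

lemma cc_tr (z w : AnnTil) (k : ℤ) : cc w - cc (tr z k) = cc (tr w (-k)) - cc z := by
  apply Complex.ext <;> simp [cc, tr]; ring

lemma Good.trans {Q : Set AnnTil} {s : ℝ} {z : AnnTil} {L : AnnTil → ℝ} {R : ℝ}
    (h : Good Q s z L R) (k : ℤ) (hQ : ∀ w ∈ Q, tr w (-k) ∈ Q) :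
    Good Q s (tr z k) (fun w => L (tr w (-k))) R := by
  refine ⟨h.cont.comp (tr_cont _).continuousOn hQ, fun w hw => ?_, fun w hw h1 => ?_,
    fun w hw h1 => ?_⟩
  · rw [cc_tr]; exact h.eq _ (hQ w hw)
  · apply h.right _ (hQ w hw)
    simp only [tr] at *; push_cast; linarith
  · apply h.left _ (hQ w hw)
    simp only [tr] at *; push_cast; linarith

def IsGood (Q : Set AnnTil) (s : ℝ) (z : AnnTil) : Prop := ∃ L R, 0 ≤ R ∧ Good Q s z L R

open Classical in
def th (Q : Set AnnTil) (s : ℝ) (z w : AnnTil) : ℝ :=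
  if h : IsGood Q s z then h.choose w else 0

lemma th_spec {Q : Set AnnTil} {s : ℝ} {z : AnnTil} (h : IsGood Q s z) :
    ∃ R, Good Q s z (th Q s z) R := by
  obtain ⟨R, -, h2⟩ := h.choose_spec
  refine ⟨R, ?_⟩
  have : th Q s z = h.choose := by funext w; simp [th, h]
  rw [this]; exact h2

lemma th_eq {Q : Set AnnTil} (hQ : Conn Q) {s : ℝ} {z : AnnTil} {L : AnnTil → ℝ} {R : ℝ}
    (h : Good Q s z L R) (hR : 0 ≤ R) (hz : z ∉ Q) : ∀ w ∈ Q, th Q s z w = L w := by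
  obtain ⟨R', h'⟩ := th_spec ⟨L, R, hR, h⟩
  exact h'.unique hQ h hz

lemma near_aux {Q : Set AnnTil} {lam : AnnTil → ℝ} (hl : Continuous lam)
    (h0 : ∀ w ∈ Q, lam w = 0) {z₀ : AnnTil} (hz : 0 < lam z₀) :
    ∀ᶠ z in 𝓝 z₀, ‖cc z - cc z₀‖ ≤ 1 ∧ z ∉ Q ∧ ∀ w ∈ Q, ‖cc z - cc z₀‖ < ‖cc w - cc z₀‖ ∧
      ‖cc z₀ - cc z‖ < ‖cc w - cc z‖ := by
  have hev : ∀ᶠ z in 𝓝 z₀, 0 < lam z := hl.continuousAt.eventually (lt_mem_nhds hz)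
  obtain ⟨ε, hε, hb⟩ := Metric.eventually_nhds_iff.1 hev
  have hfar : ∀ w ∈ Q, ε ≤ ‖cc w - cc z₀‖ := fun w hw => by
    by_contra hc
    push Not at hc
    have := hb (lt_of_le_of_lt (dist_le_cc w z₀) hc)
    rw [h0 w hw] at this
    exact lt_irrefl _ this
  have hcl : ∀ᶠ z in 𝓝 z₀, ‖cc z - cc z₀‖ < min 1 (ε / 2) := by
    have : ContinuousAt (fun z => ‖cc z - cc z₀‖) z₀ :=
      ((cc_cont.sub continuous_const).norm).continuousAt
    apply this.eventually (gt_mem_nhds _)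
    simp only [sub_self, norm_zero]
    exact lt_min one_pos (by linarith)
  filter_upwards [hcl, hev] with z hz1 hz2
  have hz3 := hz1.trans_le (min_le_right _ _)
  refine ⟨(hz1.trans_le (min_le_left _ _)).le, fun hq => ?_, fun w hw => ⟨?_, ?_⟩⟩
  · rw [h0 z hq] at hz2; exact lt_irrefl _ hz2
  · linarith [hfar w hw]
  · rw [norm_sub_rev]
    have := norm_sub_le_norm_sub_add_norm_sub (cc w) (cc z) (cc z₀)
    linarith [hfar w hw]

lemma good_nhds {Q : Set AnnTil} {s : ℝ} (hs : s = 1 ∨ s = -1) {lam : AnnTil → ℝ}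
    (hl : Continuous lam) (h0 : ∀ w ∈ Q, lam w = 0) {z₀ : AnnTil} (hz : 0 < lam z₀) :
    ∀ᶠ z in 𝓝 z₀, (IsGood Q s z ↔ IsGood Q s z₀) := by
  filter_upwards [near_aux hl h0 hz] with z ⟨h1, _, h2⟩
  constructor
  · rintro ⟨L, R, hR, h⟩
    exact ⟨_, _, by linarith, h.move hs hR z₀ (fun w hw => (h2 w hw).2)
      (by rw [norm_sub_rev]; exact h1)⟩
  · rintro ⟨L, R, hR, h⟩
    exact ⟨_, _, by linarith, h.move hs hR z (fun w hw => (h2 w hw).1) h1⟩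

lemma th_cont {Q : Set AnnTil} (hQ : Conn Q) {s : ℝ} (hs : s = 1 ∨ s = -1) {lam : AnnTil → ℝ}
    (hl : Continuous lam) (h0 : ∀ w ∈ Q, lam w = 0) {z₀ : AnnTil} (hz : 0 < lam z₀)
    (hg : IsGood Q s z₀) {F : AnnTil → AnnTil} (hF : Continuous F)
    (hFQ : ∀ᶠ z in 𝓝 z₀, F z ∈ Q) : ContinuousAt (fun z => th Q s z (F z)) z₀ := by
  obtain ⟨L, R, hR, h⟩ := hg
  have hev : (fun z => th Q s z (F z)) =ᶠ[𝓝 z₀] fun z =>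
      L (F z) + Complex.arg ((cc (F z) - cc z) / (cc (F z) - cc z₀)) := by
    filter_upwards [near_aux hl h0 hz, hFQ] with z ⟨h1, h3, h2⟩ h4
    exact th_eq hQ (h.move hs hR z (fun w hw => (h2 w hw).1) h1) (by linarith) h3 _ h4
  refine ContinuousAt.congr ?_ hev.symm
  have hq : F z₀ ∈ Q := hFQ.self_of_nhds
  have hne : cc (F z₀) - cc z₀ ≠ 0 := fun hc => by
    have := cc_inj (sub_eq_zero.1 hc)
    rw [← this, h0 _ hq] at hz
    exact lt_irrefl _ hz
  apply ContinuousAt.add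
  · have h1 : Tendsto F (𝓝 z₀) (𝓝[Q] (F z₀)) :=
      tendsto_nhdsWithin_iff.2 ⟨hF.continuousAt, hFQ⟩
    exact (h.cont _ hq).tendsto.comp h1
  · refine ContinuousAt.comp (g := Complex.arg) (Complex.continuousAt_arg ?_) ?_
    · rw [div_self hne]; exact Or.inl (by simp)
    · exact (((cc_cont.comp hF).sub cc_cont).continuousAt).div
        (((cc_cont.comp hF).sub continuous_const).continuousAt) hne

lemma seg_compact (a b : Ioo (0:ℝ) 1) :
    IsCompact {z : AnnTil | z.1 = 0 ∧ (a : ℝ) ≤ z.2 ∧ (z.2 : ℝ) ≤ b} := by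
  have hk : IsCompact (univ : Set (Icc (a : ℝ) b)) := isCompact_univ
  let φ : Icc (a:ℝ) b → AnnTil := fun y =>
    (0, ⟨y.1, lt_of_lt_of_le a.2.1 y.2.1, lt_of_le_of_lt y.2.2 b.2.2⟩)
  have hφ : Continuous φ := by fun_prop
  convert hk.image hφ
  ext z
  constructor
  · rintro ⟨h1, h2, h3⟩
    exact ⟨⟨z.2, h2, h3⟩, mem_univ _, Prod.ext h1.symm rfl⟩
  · rintro ⟨y, -, rfl⟩
    exact ⟨rfl, y.2.1, y.2.2⟩

lemma unif_R {Q : Set AnnTil} {s : ℝ} (hs : s = 1 ∨ s = -1) {lam : AnnTil → ℝ}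
    (hl : Continuous lam) (h0 : ∀ w ∈ Q, lam w = 0) (a b : Ioo (0:ℝ) 1) :
    ∃ R, 0 ≤ R ∧ ∀ z : AnnTil, z.1 = 0 → (a : ℝ) ≤ z.2 → (z.2 : ℝ) ≤ b → 1/3 ≤ lam z →
      IsGood Q s z → ∃ L, Good Q s z L R := by
  have hk : IsCompact ({z : AnnTil | z.1 = 0 ∧ (a : ℝ) ≤ z.2 ∧ (z.2 : ℝ) ≤ b} ∩
      {z | 1/3 ≤ lam z}) := (seg_compact a b).inter_right (isClosed_le continuous_const hl)
  have key : ∃ R, 0 ≤ R ∧ ∀ z ∈ ({z : AnnTil | z.1 = 0 ∧ (a : ℝ) ≤ z.2 ∧ (z.2 : ℝ) ≤ b} ∩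
      {z | 1/3 ≤ lam z}), IsGood Q s z → ∃ L, Good Q s z L R := by
    refine hk.induction_on (p := fun S => ∃ R, 0 ≤ R ∧ ∀ z ∈ S, IsGood Q s z → ∃ L, Good Q s z L R)
      ⟨0, le_rfl, fun z hz => absurd hz (notMem_empty z)⟩ ?_ ?_ ?_
    · rintro S T hST ⟨R, hR, h⟩
      exact ⟨R, hR, fun z hz => h z (hST hz)⟩
    · rintro S T ⟨R, hR, h⟩ ⟨R', hR', h'⟩
      refine ⟨max R R', le_max_of_le_left hR, fun z hz hg => ?_⟩
      rcases hz with hz | hz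
      · obtain ⟨L, hL⟩ := h z hz hg; exact ⟨L, hL.mono (le_max_left _ _)⟩
      · obtain ⟨L, hL⟩ := h' z hz hg; exact ⟨L, hL.mono (le_max_right _ _)⟩
    · rintro z₀ ⟨-, hz₀⟩
      have hz₀' : 0 < lam z₀ := lt_of_lt_of_le (by norm_num) hz₀
      by_cases hg : IsGood Q s z₀
      · obtain ⟨L, R, hR, h⟩ := hg
        refine ⟨_, mem_nhdsWithin_of_mem_nhds (near_aux hl h0 hz₀'), R + 2, by linarith, ?_⟩
        rintro z ⟨h1, -, h2⟩ -
        exact ⟨_, h.move hs hR z (fun w hw => (h2 w hw).1) h1⟩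
      · refine ⟨_, mem_nhdsWithin_of_mem_nhds (good_nhds hs hl h0 hz₀'), 0, le_rfl, ?_⟩
        intro z hz hgz
        exact absurd (hz.1 hgz) hg
  obtain ⟨R, hR, h⟩ := key
  exact ⟨R, hR, fun z h1 h2 h3 h4 => h z ⟨⟨h1, h2, h3⟩, h4⟩⟩

lemma F_tr {F : AnnTil → AnnTil} {D : ℤ} (h : ∀ z, F (tr z 1) = tr (F z) D) (z : AnnTil) (k : ℤ) :
    F (tr z k) = tr (F z) (k * D) := by
  induction k using Int.induction_on with
  | zero => simp [tr_zero]
  | succ n ih => rw [← tr_tr, h, ih, tr_tr]; congr 1; ring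
  | pred n ih =>
    have := h (tr z (-(n:ℤ) - 1))
    rw [tr_tr, sub_add_cancel, ih] at this
    have h2 := congrArg (fun w => tr w (-D)) this
    simp only [tr_tr, add_neg_cancel, tr_zero] at h2
    rw [← h2]; congr 1; ring

theorem core {F : AnnTil → AnnTil} (hF : Continuous F) {D : ℤ} (hD : 1 < |D|)
    (hFt : ∀ z, F (tr z 1) = tr (F z) D) {Ut : Set AnnTil} (hUo : IsOpen Ut)
    (hUt : ∀ z ∈ Ut, ∀ k, tr z k ∈ Ut) {lam : AnnTil → ℝ} (hl : Continuous lam)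
    (hper : ∀ z k, lam (tr z k) = lam z)
    (h0 : ∀ z ∈ Ut, lam (F z) = 0) (h1 : ∀ z, z ∉ Ut → lam z = 1)
    (a b : Ioo (0:ℝ) 1) (hUab : ∀ z ∈ Ut, (a : ℝ) < z.2 ∧ (z.2 : ℝ) < b)
    (hUF : ∀ z ∈ Ut, F z ∈ Ut)
    (hne : Ut.Nonempty) (hconn : Conn (F '' Ut)) : ∃ z, F z = z := by
  classical
  by_contra hfix
  push Not at hfix
  set Q := F '' Ut with hQdef
  have h0Q : ∀ w ∈ Q, lam w = 0 := by rintro _ ⟨z, hz, rfl⟩; exact h0 z hz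
  have hQU : ∀ w ∈ Q, w ∈ Ut := by rintro _ ⟨z, hz, rfl⟩; exact hUF z hz
  have hQne : Q.Nonempty := hne.image F
  have hQt : ∀ k : ℤ, ∀ w ∈ Q, tr w (k * D) ∈ Q := by
    rintro k _ ⟨z, hz, rfl⟩
    exact ⟨tr z k, hUt z hz k, F_tr hFt z k⟩
  have hpi := Real.pi_pos
  have hab : (a : ℝ) < b := by
    obtain ⟨z, hz⟩ := hne
    exact (hUab z hz).1.trans (hUab z hz).2
  have hnz : ∀ z, cc (F z) - cc z ≠ 0 := fun z h => hfix z (cc_inj (sub_eq_zero.1 h))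
  have hnn : ∀ z, (‖cc (F z) - cc z‖ : ℂ) ≠ 0 := fun z => by
    exact_mod_cast norm_ne_zero_iff.2 (hnz z)
  -- cut-off and reference angle
  let mu : AnnTil → ℝ := fun z => max 0 (min 1 (3 * lam z - 1))
  have hmu : Continuous mu := by fun_prop
  have hmu0 : ∀ z, 0 ≤ mu z := fun z => le_max_left _ _
  have hmu1 : ∀ z, mu z ≤ 1 := fun z => max_le zero_le_one (min_le_left _ _)
  have hmuz : ∀ z, lam z ≤ 1/3 → mu z = 0 := fun z hz => by
    apply max_eq_left
    exact (min_le_right _ _).trans (by linarith)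
  have hmuo : ∀ z, 2/3 ≤ lam z → mu z = 1 := fun z hz => by
    simp only [mu]
    rw [min_eq_left (by linarith), max_eq_right zero_le_one]
  let al : AnnTil → ℝ := fun z => -(Real.pi / 2) + Real.arctan (z.1 / D)
  have hal : Continuous al := by
    have : Continuous fun z : AnnTil => z.1 / (D:ℝ) := continuous_fst.div_const _
    exact continuous_const.add (Real.continuous_arctan.comp this)
  have hal0 : ∀ z, al z < 0 := fun z => by
    have := Real.arctan_lt_pi_div_two (z.1 / D); simp only [al]; linarith
  have hal1 : ∀ z, -Real.pi < al z := fun z => by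
    have := Real.neg_pi_div_two_lt_arctan (z.1 / D); simp only [al]; linarith
  let ang : ℝ → AnnTil → ℝ := fun s z => (1 - mu z) * th Q s z (F z) + mu z * (-s * al z)
  let VA : ℝ → AnnTil → ℂ := fun s z => Complex.exp (ang s z * Complex.I)
  let V0 : AnnTil → ℂ := fun z => (cc (F z) - cc z) / ‖cc (F z) - cc z‖
  let V : AnnTil → ℂ := fun z =>
    if IsGood Q (-1) z then VA (-1) z else if IsGood Q 1 z then VA 1 z else V0 z
  have hV0 : Continuous V0 := by
    refine ((cc_cont.comp hF).sub cc_cont).div ?_ hnn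
    exact Complex.continuous_ofReal.comp ((cc_cont.comp hF).sub cc_cont).norm
  have hVnorm : ∀ z, ‖V z‖ = 1 := fun z => by
    have hA : ∀ s, ‖VA s z‖ = 1 := fun s => Complex.norm_exp_ofReal_mul_I _
    simp only [V]
    split_ifs
    · exact hA _
    · exact hA _
    · simp only [V0]
      rw [norm_div, Complex.norm_real, norm_norm]
      exact div_self (norm_ne_zero_iff.2 (hnz z))
  have memU : ∀ z, lam z < 1 → z ∈ Ut := fun z hz => by
    by_contra h; rw [h1 z h] at hz; exact lt_irrefl _ hz
  -- where the cut-off vanishes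
  have hA0 : ∀ s z, lam z ≤ 1/3 → IsGood Q s z → VA s z = V0 z := fun s z hz hg => by
    obtain ⟨R, hR⟩ := th_spec hg
    have e := hR.eq (F z) ⟨z, memU z (by linarith), rfl⟩
    simp only [VA, V0, ang]
    rw [hmuz z hz, sub_zero, one_mul, zero_mul, add_zero, eq_div_iff (hnn z), mul_comm]
    exact e.symm
  have hV_0 : ∀ z, lam z ≤ 1/3 → V z = V0 z := fun z hz => by
    simp only [V]
    split_ifs with c1 c2
    · exact hA0 _ z hz c1
    · exact hA0 _ z hz c2
    · rfl
  have hVAc : ∀ s, (s = 1 ∨ s = -1) → ∀ z, 0 < lam z → IsGood Q s z →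
      ContinuousAt (VA s) z := fun s hs z hz hg => by
    have hang : ContinuousAt (ang s) z := by
      have hsec : Continuous fun z => mu z * (-s * al z) := by fun_prop
      rcases lt_or_ge (2/3) (lam z) with c | c
      · have : ang s =ᶠ[𝓝 z] fun z => mu z * (-s * al z) := by
          filter_upwards [hl.continuousAt.eventually (lt_mem_nhds c)] with y hy
          simp only [ang]
          rw [hmuo y hy.le]; ring
        exact hsec.continuousAt.congr this.symm
      · have hzU := memU z (by linarith)
        have hev : ∀ᶠ y in 𝓝 z, F y ∈ Q := by
          filter_upwards [hUo.mem_nhds hzU] with y hy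
          exact ⟨y, hy, rfl⟩
        exact ((continuous_const.sub hmu).continuousAt.mul
          (th_cont hconn hs hl h0Q hz hg hF hev)).add hsec.continuousAt
    have : Continuous fun t : ℝ => Complex.exp (t * Complex.I) := by fun_prop
    exact ContinuousAt.comp (g := fun t : ℝ => Complex.exp (t * Complex.I))
      this.continuousAt hang
  have hVc : Continuous V := by
    rw [continuous_iff_continuousAt]
    intro z
    rcases lt_or_ge (lam z) (1/3) with c | c
    · have : V =ᶠ[𝓝 z] V0 := by
        filter_upwards [hl.continuousAt.eventually (gt_mem_nhds c)] with y hy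
        exact hV_0 y hy.le
      exact hV0.continuousAt.congr this.symm
    · have hz : 0 < lam z := by linarith
      have e1 := good_nhds (s := -1) (Or.inr rfl) hl h0Q hz
      have e2 := good_nhds (s := 1) (Or.inl rfl) hl h0Q hz
      by_cases c1 : IsGood Q (-1) z
      · have : V =ᶠ[𝓝 z] VA (-1) := by
          filter_upwards [e1] with y hy
          simp only [V]; rw [if_pos (hy.2 c1)]
        exact (hVAc _ (Or.inr rfl) z hz c1).congr this.symm
      · by_cases c2 : IsGood Q 1 z
        · have : V =ᶠ[𝓝 z] VA 1 := by
            filter_upwards [e1, e2] with y hy hy2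
            simp only [V]; rw [if_neg (fun h => c1 (hy.1 h)), if_pos (hy2.2 c2)]
          exact (hVAc _ (Or.inl rfl) z hz c2).congr this.symm
        · have : V =ᶠ[𝓝 z] V0 := by
            filter_upwards [e1, e2] with y hy hy2
            simp only [V]; rw [if_neg (fun h => c1 (hy.1 h)), if_neg (fun h => c2 (hy2.1 h))]
          exact hV0.continuousAt.congr this.symm
  -- uniform constants
  obtain ⟨R1, hR1, hu1⟩ := unif_R (s := 1) (Or.inl rfl) hl h0Q a b
  obtain ⟨R2, hR2, hu2⟩ := unif_R (s := -1) (Or.inr rfl) hl h0Q a b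
  obtain ⟨R0, hR0, hu⟩ : ∃ R, 0 ≤ R ∧ ∀ s, (s = 1 ∨ s = -1) → ∀ z : AnnTil, z.1 = 0 →
      (a : ℝ) ≤ z.2 → (z.2 : ℝ) ≤ b → 1/3 ≤ lam z → IsGood Q s z → ∃ L, Good Q s z L R := by
    refine ⟨max R1 R2, le_max_of_le_left hR1, ?_⟩
    rintro s (rfl | rfl) z c1 c2 c3 c4 c5
    · obtain ⟨L, hL⟩ := hu1 z c1 c2 c3 c4 c5; exact ⟨L, hL.mono (le_max_left _ _)⟩
    · obtain ⟨L, hL⟩ := hu2 z c1 c2 c3 c4 c5; exact ⟨L, hL.mono (le_max_right _ _)⟩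
  obtain ⟨C, hC⟩ := (seg_compact a b).exists_bound_of_continuousOn
    (f := fun z => (F z).1) (continuous_fst.comp hF).continuousOn
  have hth : ∀ s, (s = 1 ∨ s = -1) → ∀ (z : AnnTil) (k : ℤ), z.1 = 0 → (a : ℝ) ≤ z.2 →
      (z.2 : ℝ) ≤ b → 1/3 ≤ lam z → IsGood Q s (tr z (k * D)) → 
      ∃ L, Good Q s (tr z (k * D)) L R0 ∧ ∀ w ∈ Q, th Q s (tr z (k * D)) w = L w := by
    intro s hs z k c1 c2 c3 c4 hg
    have hg0 : IsGood Q s z := by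
      obtain ⟨L, R, hR, hgd⟩ := hg
      have := hgd.trans (-k * D) (fun w hw => by
        rw [show -(-k * D) = k * D by ring]; exact hQt k w hw)
      rw [tr_tr, show k * D + -k * D = 0 by ring, tr_zero] at this
      exact ⟨_, R, hR, this⟩
    obtain ⟨L, hL⟩ := hu s hs z c1 c2 c3 c4 hg0
    have hL' := hL.trans (k * D) (fun w hw => by
      rw [show -(k * D) = (-k) * D by ring]; exact hQt (-k) w hw)
    refine ⟨_, hL', th_eq hconn hL' hR0 fun hq => ?_⟩
    have := h0Q _ hq
    rw [hper] at this
    linarith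
  have hV0re : ∀ z, (V0 z).re = ((F z).1 - z.1) / ‖cc (F z) - cc z‖ := fun z => by
    simp only [V0]; rw [Complex.div_ofReal_re]; simp [cc]
  have hnpos : ∀ z, 0 < ‖cc (F z) - cc z‖ := fun z => norm_pos_iff.2 (hnz z)
  have hVAre : ∀ s z, (VA s z).re = Real.cos (ang s z) := fun s z =>
    Complex.exp_ofReal_mul_I_re _
  have hVAim : ∀ s z, (VA s z).im = Real.sin (ang s z) := fun s z =>
    Complex.exp_ofReal_mul_I_im _
  have hDne : (D : ℝ) ≠ 0 := by
    intro h; have : D = 0 := by exact_mod_cast h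
    rw [this] at hD; norm_num at hD
  have hDD : (1 : ℝ) ≤ (D:ℝ) * D - D := by
    have : 1 ≤ D * D - D := by
      rcases lt_abs.1 hD with h | h <;> nlinarith
    exact_mod_cast this
  obtain ⟨N, hN⟩ := exists_nat_ge (max 1 (C + R0 + 1))
  have hN1 : (1:ℝ) ≤ N := (le_max_left _ _).trans hN
  have hN2 : C + R0 + 1 ≤ N := (le_max_right _ _).trans hN
  have hN3 : (N:ℝ) ≤ N * ((D:ℝ) * D - D) := by nlinarith
  -- convexity
  have conv : ∀ (m x y c : ℝ), 0 ≤ m → m ≤ 1 → |x - c| < Real.pi/2 → |y - c| < Real.pi/2 →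
      |((1 - m) * x + m * y) - c| < Real.pi/2 := by
    intro m x y c m0 m1 hx hy
    rw [abs_lt] at *
    rcases eq_or_lt_of_le m0 with rfl | m0
    · constructor <;> linarith
    · constructor <;> nlinarith
  -- right side
  have hright : ∀ z : AnnTil, z.1 = 0 → (a:ℝ) ≤ z.2 → (z.2:ℝ) ≤ b →
      0 < (V (tr z (N * D))).re := by
    intro z c1 c2 c3
    have hz1 : (tr z (N * D)).1 = N * D := by simp [tr, c1]
    have hFz : (tr z (N * D)).1 + R0 + 1 ≤ (F (tr z (N * D))).1 := by
      rw [hz1, F_tr hFt]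
      have := (abs_le.1 (hC z ⟨c1, c2, c3⟩)).1
      simp only [tr]; push_cast
      nlinarith
    have hA : ∀ s, (s = 1 ∨ s = -1) → IsGood Q s (tr z (N * D)) → 1/3 ≤ lam z →
        0 < (VA s (tr z (N * D))).re := by
      intro s hs hg hlz
      rw [hVAre]
      have hals : |-s * al (tr z (N * D)) - 0| < Real.pi/2 := by
        have : 0 < Real.arctan ((tr z (N * D)).1 / D) := by
          rw [hz1, mul_div_assoc, div_self hDne, mul_one]
          exact Real.arctan_pos.2 (by linarith)
        have h3 := hal0 (tr z (N * D))
        rw [sub_zero, abs_lt]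
        simp only [al] at h3 ⊢
        rcases hs with rfl | rfl <;> constructor <;> linarith
      have hb : |ang s (tr z (N * D)) - 0| < Real.pi/2 := by
        by_cases hU : tr z (N * D) ∈ Ut
        · obtain ⟨L, hL, hLe⟩ := hth s hs z N c1 c2 c3 hlz hg
          have hFQ : F (tr z (N * D)) ∈ Q := ⟨_, hU, rfl⟩
          apply conv _ _ _ _ (hmu0 _) (hmu1 _) _ hals
          rw [hLe _ hFQ, sub_zero]
          exact hL.right _ hFQ (by linarith)
        · simp only [ang]
          rw [hmuo _ (by rw [h1 _ hU]; norm_num), sub_self, zero_mul, zero_add, one_mul]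
          exact hals
      rw [sub_zero, abs_lt] at hb
      exact Real.cos_pos_of_mem_Ioo hb
    have hB : 0 < (V0 (tr z (N * D))).re := by
      rw [hV0re]
      exact div_pos (by linarith) (hnpos _)
    rcases le_total (lam z) (1/3) with c | c
    · rw [hV_0 _ (by rw [hper]; exact c)]; exact hB
    · simp only [V]
      split_ifs with g1 g2
      · exact hA _ (Or.inr rfl) g1 c
      · exact hA _ (Or.inl rfl) g2 c
      · exact hB
  have hleft : ∀ z : AnnTil, z.1 = 0 → (a:ℝ) ≤ z.2 → (z.2:ℝ) ≤ b →
      (V (tr z (-N * D))).re < 0 := by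
    intro z c1 c2 c3
    have hz1 : (tr z (-N * D)).1 = -N * D := by simp [tr, c1]
    have hFz : (F (tr z (-N * D))).1 ≤ (tr z (-N * D)).1 - R0 - 1 := by
      rw [hz1, F_tr hFt]
      have := (abs_le.1 (hC z ⟨c1, c2, c3⟩)).2
      simp only [tr]; push_cast
      nlinarith
    have hA : ∀ s, (s = 1 ∨ s = -1) → IsGood Q s (tr z (-N * D)) → 1/3 ≤ lam z →
        (VA s (tr z (-N * D))).re < 0 := by
      intro s hs hg hlz
      rw [hVAre]
      have hals : |-s * al (tr z (-N * D)) - s * Real.pi| < Real.pi/2 := by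
        have : Real.arctan ((tr z (-N * D)).1 / D) < 0 := by
          rw [hz1, mul_div_assoc, div_self hDne, mul_one]
          exact Real.arctan_lt_zero.2 (by linarith)
        have h3 := hal1 (tr z (-N * D))
        rw [abs_lt]
        simp only [al] at h3 ⊢
        rcases hs with rfl | rfl <;> constructor <;> linarith
      have hb : |ang s (tr z (-N * D)) - s * Real.pi| < Real.pi/2 := by
        by_cases hU : tr z (-N * D) ∈ Ut
        · obtain ⟨L, hL, hLe⟩ := hth s hs z (-N) c1 c2 c3 hlz hg
          have hFQ : F (tr z (-N * D)) ∈ Q := ⟨_, hU, rfl⟩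
          apply conv _ _ _ _ (hmu0 _) (hmu1 _) _ hals
          rw [hLe _ hFQ]
          exact hL.left _ hFQ (by linarith)
        · simp only [ang]
          rw [hmuo _ (by rw [h1 _ hU]; norm_num), sub_self, zero_mul, zero_add, one_mul]
          exact hals
      rw [abs_lt] at hb
      have := Real.cos_pos_of_mem_Ioo hb
      rw [cos_shift hs] at this
      linarith
    have hB : (V0 (tr z (-N * D))).re < 0 := by
      rw [hV0re]
      exact div_neg_of_neg_of_pos (by linarith) (hnpos _)
    rcases le_total (lam z) (1/3) with c | c
    · rw [hV_0 _ (by rw [hper]; exact c)]; exact hB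
    · simp only [V]
      split_ifs with g1 g2
      · exact hA _ (Or.inr rfl) g1 c
      · exact hA _ (Or.inl rfl) g2 c
      · exact hB
  -- top and bottom
  have htop : ∀ z : AnnTil, (z.2:ℝ) = b → (V z).im < 0 := by
    intro z hz
    have hg : IsGood Q (-1) z := ⟨_, 1, zero_le_one, good_top fun w hw => by
      rw [hz]; exact (hUab w (hQU w hw)).2⟩
    have hzU : z ∉ Ut := fun h => by have := (hUab z h).2; linarith
    simp only [V]
    rw [if_pos hg, hVAim]
    simp only [ang]
    rw [hmuo _ (by rw [h1 _ hzU]; norm_num), sub_self, zero_mul, zero_add, one_mul, neg_neg, one_mul]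
    exact Real.sin_neg_of_neg_of_neg_pi_lt (hal0 z) (hal1 z)
  have hbot : ∀ z : AnnTil, (z.2:ℝ) = a → 0 < (V z).im := by
    intro z hz
    have hg : Good Q 1 z _ 1 := good_bot fun w hw => by
      rw [hz]; exact (hUab w (hQU w hw)).1
    have hzU : z ∉ Ut := fun h => by have := (hUab z h).1; linarith
    have hng : ¬ IsGood Q (-1) z := by
      rintro ⟨L, R, hR, h⟩
      exact h.disj hconn hQne hg (fun h => hzU (hQU z h))
    simp only [V]
    rw [if_neg hng, if_pos ⟨_, 1, zero_le_one, hg⟩, hVAim]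
    simp only [ang]
    rw [hmuo _ (by rw [h1 _ hzU]; norm_num), sub_self, zero_mul, zero_add, one_mul, neg_one_mul]
    apply Real.sin_pos_of_pos_of_lt_pi
    · linarith [hal0 z]
    · linarith [hal1 z]
  -- conclusion
  let pj : ℝ → Ioo (0:ℝ) 1 := fun y => ⟨max a (min b y), lt_max_of_lt_left a.2.1,
    max_lt a.2.2 (lt_of_le_of_lt (min_le_left _ _) b.2.2)⟩
  have hpj : Continuous pj := by fun_prop
  have hpjv : ∀ y ∈ Icc (a:ℝ) b, (pj y : ℝ) = y := fun y hy => by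
    simp only [pj]; rw [min_eq_right hy.2, max_eq_right hy.1]
  refine miranda (fun p => V (p.1 * D, pj p.2)) ?_ (fun p => hVnorm _) N a b (by linarith) hab.le
    ?_ ?_ ?_ ?_
  · exact hVc.comp (by fun_prop)
  · intro y hy
    have := hright (0, pj y) rfl (by rw [hpjv y hy]; exact hy.1) (by rw [hpjv y hy]; exact hy.2)
    simpa [tr] using this
  · intro y hy
    have := hleft (0, pj y) rfl (by rw [hpjv y hy]; exact hy.1) (by rw [hpjv y hy]; exact hy.2)
    simpa [tr] using this
  · intro t _
    exact htop _ (hpjv b ⟨hab.le, le_rfl⟩)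
  · intro t _
    exact hbot _ (hpjv a ⟨le_rfl, hab.le⟩)

lemma pr_cont : Continuous pr := by unfold pr; fun_prop

lemma pr_tr (z : AnnTil) (k : ℤ) : pr (tr z k) = pr z := by
  simp only [pr, tr]
  refine Prod.ext ?_ rfl
  refine Circle.exp_eq_exp.2 ⟨k, ?_⟩
  ring

lemma pr_eq {z w : AnnTil} (h : pr z = pr w) : ∃ k : ℤ, w = tr z k := by
  have h1 := congrArg Prod.fst h
  have h2 := congrArg Prod.snd h
  simp only [pr] at h1 h2
  obtain ⟨m, hm⟩ := Circle.exp_eq_exp.1 h1.symm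
  refine ⟨m, Prod.ext ?_ h2.symm⟩
  simp only [tr]
  have : (2 * Real.pi) * w.1 = (2 * Real.pi) * (z.1 + m) := by rw [hm]; ring
  exact mul_left_cancel₀ (by positivity) this

lemma pr_surj (p : Ann) : ∃ z, pr z = p := by
  obtain ⟨x, hx⟩ := Circle.exp_surjective p.1
  refine ⟨(x / (2 * Real.pi), p.2), Prod.ext ?_ rfl⟩
  simp only [pr]
  rw [mul_div_cancel₀ _ (by positivity)]
  exact hx

lemma tr_inj {z : AnnTil} {k l : ℤ} (h : tr z k = tr z l) : k = l := by
  have := congrArg Prod.fst h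
  simp only [tr] at this
  exact_mod_cast add_left_cancel this

lemma lift_exists (γ : C(unitInterval, Ann)) (z : AnnTil) (h : pr z = γ 0) :
    ∃ Γ : C(unitInterval, AnnTil), (∀ t, pr (Γ t) = γ t) ∧ Γ 0 = z := by
  let γ1 : C(unitInterval, Circle) := ⟨fun t => (γ t).1, by fun_prop⟩
  obtain ⟨G, hG, hG0⟩ := Circle.isCoveringMap_exp.exists_path_lifts γ1 (2 * Real.pi * z.1)
    (by simp only [γ1, ContinuousMap.coe_mk]; rw [← h]; rfl)
  refine ⟨⟨fun t => (G t / (2 * Real.pi), (γ t).2), by fun_prop⟩, fun t => ?_, ?_⟩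
  · refine Prod.ext ?_ rfl
    simp only [pr, ContinuousMap.coe_mk]
    rw [mul_div_cancel₀ _ (by positivity)]
    exact congrFun hG t
  · simp only [ContinuousMap.coe_mk]
    rw [hG0, ← h]
    refine Prod.ext ?_ rfl
    simp only
    field_simp

lemma lift_end (Γ₀ Γ₁ : C(unitInterval, AnnTil)) (h0 : Γ₀ 0 = Γ₁ 0)
    {γ₀ γ₁ : C(unitInterval, Ann)} (e0 : ∀ t, pr (Γ₀ t) = γ₀ t) (e1 : ∀ t, pr (Γ₁ t) = γ₁ t)
    (h : γ₀.HomotopicRel γ₁ {0, 1}) : Γ₀ 1 = Γ₁ 1 := by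
  let q : C(Ann, Circle) := ⟨Prod.fst, continuous_fst⟩
  have hh : (q.comp γ₀).HomotopicRel (q.comp γ₁) {0,1} := h.map fun H => H.compContinuousMap q
  let cov := Circle.isCoveringMap_exp
  let Λ : C(unitInterval, AnnTil) → C(unitInterval, ℝ) := fun Γ =>
    ⟨fun t => 2 * Real.pi * (Γ t).1, by fun_prop⟩
  have k0 : ∀ t, Circle.exp (Λ Γ₀ t) = (q.comp γ₀) t := fun t => congrArg Prod.fst (e0 t)
  have k1 : ∀ t, Circle.exp (Λ Γ₁ t) = (q.comp γ₁) t := fun t => congrArg Prod.fst (e1 t)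
  have hz : Λ Γ₁ 0 = Λ Γ₀ 0 := by simp only [Λ, ContinuousMap.coe_mk, h0]
  have key := cov.liftPath_apply_one_eq_of_homotopicRel hh (Λ Γ₀ 0) (k0 0).symm
    (by rw [← hz]; exact (k1 0).symm)
  rw [← (cov.eq_liftPath_iff' (Γ := Λ Γ₀) _).2 ⟨funext k0, rfl⟩,
    ← (cov.eq_liftPath_iff' (Γ := Λ Γ₁) _).2 ⟨funext k1, hz⟩] at key
  refine Prod.ext ?_ ?_
  · exact mul_left_cancel₀ (by positivity : (2 * Real.pi) ≠ 0) key
  · have : γ₀ 1 = γ₁ 1 := by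
      obtain ⟨H⟩ := h
      rw [← H.eq_fst 0 (show (1:unitInterval) ∈ ({0,1} : Set unitInterval) by simp),
        ← H.eq_snd 0 (show (1:unitInterval) ∈ ({0,1} : Set unitInterval) by simp)]
    rw [← e0, ← e1] at this
    exact (congrArg Prod.snd this : (pr (Γ₀ 1)).2 = (pr (Γ₁ 1)).2)

instance : ContractibleSpace (Ioo (0:ℝ) 1) :=
  (convex_Ioo (0:ℝ) 1).contractibleSpace ⟨1/2, by norm_num, by norm_num⟩

instance annTil_sc : SimplyConnectedSpace AnnTil := by
  infer_instance

/-- Two lifted paths with the same endpoints project to homotopic paths. -/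
lemma homotopic_of_lifts {p q : Ann} (γ₀ γ₁ : Path p q) (Γ₀ Γ₁ : C(unitInterval, AnnTil))
    (h0 : Γ₀ 0 = Γ₁ 0) (h1 : Γ₀ 1 = Γ₁ 1)
    (e0 : ∀ t, pr (Γ₀ t) = γ₀ t) (e1 : ∀ t, pr (Γ₁ t) = γ₁ t) : γ₀.Homotopic γ₁ := by
  let P₀ : Path (Γ₀ 0) (Γ₀ 1) := ⟨Γ₀, rfl, rfl⟩
  let P₁ : Path (Γ₀ 0) (Γ₀ 1) := ⟨Γ₁, h0.symm, h1.symm⟩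
  have hP : P₀.Homotopic P₁ := SimplyConnectedSpace.paths_homotopic P₀ P₁
  have hm := hP.map (⟨pr, pr_cont⟩ : C(AnnTil, Ann))
  have hp : p = pr (Γ₀ 0) := by rw [e0, γ₀.source]
  have hq : q = pr (Γ₀ 1) := by rw [e0, γ₀.target]
  subst hp hq
  have g0 : γ₀ = P₀.map pr_cont := by ext1; funext t; exact (e0 t).symm
  have g1 : γ₁ = P₁.map pr_cont := by ext1; funext t; exact (e1 t).symm
  rw [g0, g1]; exact hm

instance circle_lpc : LocallyPathConnectedSpace Circle :=
  (Circle.isCoveringMap_exp.isQuotientMap Circle.exp_surjective).locallyPathConnectedSpace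

instance ioo_lpc : LocallyPathConnectedSpace (Ioo (0:ℝ) 1) :=
  isOpen_Ioo.locallyPathConnectedSpace

lemma conn_lift {U : Set Ann} (hUo : IsOpen U) (hUc : IsConnected U)
    (hUess : ∃ (x : Ann) (γ : Path x x), Set.range γ ⊆ U ∧ ¬ γ.Homotopic (Path.refl x))
    (z : AnnTil) (hz : pr z ∈ U) :
    ∃ z₁ : AnnTil, ∃ k : ℤ, k ≠ 0 ∧ ∀ m : ℤ, JoinedIn (pr ⁻¹' U) z (tr z₁ (m * k)) := by
  obtain ⟨x, γ, hγ, hγn⟩ := hUess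
  have hx : x ∈ U := hγ ⟨0, γ.source⟩
  have hpc : IsPathConnected U := (hUo.isConnected_iff_isPathConnected).1 hUc
  obtain ⟨δ, hδ⟩ := hpc.joinedIn _ hz _ hx
  obtain ⟨Δ, hΔ, hΔ0⟩ := lift_exists δ.toContinuousMap z δ.source.symm
  have hΔ1 : pr (Δ 1) = x := (hΔ 1).trans δ.target
  obtain ⟨Γ, hΓ, hΓ0⟩ := lift_exists γ.toContinuousMap (Δ 1) (hΔ1.trans γ.source.symm)
  have hΓ1 : pr (Γ 1) = x := (hΓ 1).trans γ.target
  obtain ⟨k, hk⟩ := pr_eq (hΔ1.trans hΓ1.symm)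
  have j0 : JoinedIn (pr ⁻¹' U) z (Δ 1) :=
    ⟨⟨Δ, hΔ0, rfl⟩, fun t => by
      change pr (Δ t) ∈ U
      rw [hΔ]; exact hδ t⟩
  have j1 : ∀ l : ℤ, JoinedIn (pr ⁻¹' U) (tr (Δ 1) l) (tr (Δ 1) (l + k)) := fun l =>
    ⟨⟨⟨fun t => tr (Γ t) l, (tr_cont l).comp Γ.continuous⟩, by simp [hΓ0], by
      simp only [hk, tr_tr]; rw [add_comm]⟩, fun t => by
      change pr (tr (Γ t) l) ∈ U
      rw [pr_tr, hΓ]; exact hγ ⟨t, rfl⟩⟩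
  refine ⟨Δ 1, k, ?_, ?_⟩
  · rintro rfl
    rw [tr_zero] at hk
    exact hγn (homotopic_of_lifts γ (Path.refl x) Γ (ContinuousMap.const _ (Δ 1)) hΓ0 hk hΓ
      (fun t => hΔ1))
  · intro m
    induction m using Int.induction_on with
    | zero => rw [zero_mul, tr_zero]; exact j0
    | succ n ih =>
      have := j1 (n * k)
      rw [show (n:ℤ) * k + k = (n + 1) * k by ring] at this
      exact ih.trans this
    | pred n ih =>
      have := j1 ((-(n:ℤ) - 1) * k)
      rw [show (-(n:ℤ) - 1) * k + k = (-n) * k by ring] at this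
      exact ih.trans this.symm

lemma conn_image {U : Set Ann} (hUo : IsOpen U) (hUc : IsConnected U)
    (hUess : ∃ (x : Ann) (γ : Path x x), Set.range γ ⊆ U ∧ ¬ γ.Homotopic (Path.refl x))
    {F : AnnTil → AnnTil} (hF : Continuous F) {D : ℤ} (hD : D ≠ 0)
    (hFt : ∀ z, F (tr z 1) = tr (F z) D) : Conn (F '' (pr ⁻¹' U)) := by
  rintro _ ⟨z, hz, rfl⟩
  obtain ⟨z₁, k, hk, hj⟩ := conn_lift hUo hUc hUess z hz
  have hval : ∀ m : ℤ, (F (tr z₁ (m * k))).1 = (F z₁).1 + m * (k * D : ℤ) := fun m => by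
    rw [F_tr hFt]; simp only [tr]; push_cast; ring
  have hin : ∀ m : ℤ, F (tr z₁ (m * k)) ∈ F '' (pathComponentIn (pr ⁻¹' U) z) := fun m =>
    ⟨_, hj m, rfl⟩
  have hkD : k * D ≠ 0 := mul_ne_zero hk hD
  have hE : (1:ℝ) ≤ ((k * D : ℤ) : ℝ) * (k * D : ℤ) := by
    have h1 : 0 < (k * D) * (k * D) := mul_self_pos.2 hkD
    have h2 : 1 ≤ (k * D) * (k * D) := h1
    exact_mod_cast h2
  generalize k * D = E at hval hE
  refine ⟨F '' (pathComponentIn (pr ⁻¹' U) z), image_mono pathComponentIn_subset, ?_,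
    ⟨z, mem_pathComponentIn_self hz, rfl⟩, ?_, ?_⟩
  · exact ((isPathConnected_pathComponentIn hz).isConnected.isPreconnected).image _ hF.continuousOn
  · intro M
    obtain ⟨n, hn⟩ := exists_nat_ge (|M - (F z₁).1|)
    refine ⟨_, hin (n * E), ?_⟩
    rw [hval]
    push_cast
    have h2 := le_abs_self (M - (F z₁).1)
    have h3 : (0:ℝ) ≤ n := by positivity
    nlinarith
  · intro M
    obtain ⟨n, hn⟩ := exists_nat_ge (|M - (F z₁).1|)
    refine ⟨_, hin (-n * E), ?_⟩
    rw [hval]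
    push_cast
    have h2 := neg_abs_le (M - (F z₁).1)
    have h3 : (0:ℝ) ≤ n := by positivity
    nlinarith

lemma y_bounds {U : Set Ann} (hne : U.Nonempty) (hcpt : IsCompact (closure U)) :
    ∃ a b : Ioo (0:ℝ) 1, ∀ p ∈ U, (a:ℝ) < p.2 ∧ (p.2:ℝ) < b := by
  have hc : Continuous fun p : Ann => (p.2 : ℝ) := by fun_prop
  obtain ⟨p, -, hp⟩ := hcpt.exists_isMinOn hne.closure hc.continuousOn
  obtain ⟨q, -, hq⟩ := hcpt.exists_isMaxOn hne.closure hc.continuousOn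
  have p1 := p.2.2.1
  have p2 := p.2.2.2
  have q1 := q.2.2.1
  have q2 := q.2.2.2
  refine ⟨⟨(p.2:ℝ) / 2, by linarith, by linarith⟩, ⟨(1 + (q.2:ℝ)) / 2, by linarith, by linarith⟩,
    fun u hu => ?_⟩
  have h1 : (p.2:ℝ) ≤ u.2 := hp (subset_closure hu)
  have h2 : (u.2:ℝ) ≤ q.2 := hq (subset_closure hu)
  constructor
  · change (p.2:ℝ) / 2 < _; linarith
  · change _ < (1 + (q.2:ℝ)) / 2; linarith

lemma fixed_lift {g : Ann → Ann} {F : AnnTil → AnnTil} (hF : Continuous F)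
    (hlift : ∀ z, pr (F z) = g (pr z)) {D : ℤ} (hD : 1 < |D|)
    (hFt : ∀ z, F (tr z 1) = tr (F z) D)
    {U : Set Ann} (hUo : IsOpen U) (hUc : IsConnected U) (hUcl : IsCompact (closure U))
    (hUess : ∃ (x : Ann) (γ : Path x x), Set.range γ ⊆ U ∧ ¬ γ.Homotopic (Path.refl x))
    (hattr : closure (g '' U) ⊆ U) : ∃ z, F z = z := by
  obtain ⟨a, b, hab⟩ := y_bounds hUc.nonempty hUcl
  obtain ⟨l, hl0, hl1, -⟩ := exists_continuous_zero_one_of_isClosed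
    (isClosed_closure (s := g '' U)) hUo.isClosed_compl
    (disjoint_compl_right_iff_subset.2 hattr)
  have hD0 : D ≠ 0 := by rintro rfl; norm_num at hD
  have hgU : ∀ z, pr z ∈ U → pr (F z) ∈ closure (g '' U) := fun z hz => by
    rw [hlift]; exact subset_closure ⟨_, hz, rfl⟩
  obtain ⟨p, hp⟩ := hUc.nonempty
  obtain ⟨z, hz⟩ := pr_surj p
  refine core hF hD hFt (Ut := pr ⁻¹' U) (hUo.preimage pr_cont) ?_ (lam := fun z => l (pr z))
    (l.continuous.comp pr_cont) ?_ ?_ ?_ a b ?_ ?_ ⟨z, ?_⟩ (conn_image hUo hUc hUess hF hD0 hFt)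
  · intro z hz k
    change pr (tr z k) ∈ U
    rw [pr_tr]; exact hz
  · intro z k; simp only [pr_tr]
  · intro z hz; exact hl0 (hgU z hz)
  · intro z hz; exact hl1 hz
  · intro z hz; exact hab _ hz
  · intro z hz; exact hattr (hgU z hz)
  · change pr z ∈ U; rw [hz]; exact hp


lemma small_arith {E j : ℤ} {r s : ℕ} (hr : r < E.natAbs) (hs : s < E.natAbs)
    (h : (r:ℤ) - s = E * j) : r = s := by
  have h1 : ((E.natAbs : ℕ) : ℤ) ∣ (r:ℤ) - s := Int.natAbs_dvd.2 ⟨j, h⟩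
  have h2 := Int.eq_zero_of_abs_lt_dvd h1 (by rw [abs_lt]; omega)
  omega

lemma count_classes {g : Ann → Ann} {F : AnnTil → AnnTil} (hg : Continuous g) (hF : Continuous F)
    (hlift : ∀ z, pr (F z) = g (pr z)) {D : ℤ} (hD : 1 < |D|)
    (hFt : ∀ z, F (tr z 1) = tr (F z) D) (hfix : ∀ r : ℤ, ∃ z, F z = tr z r) :
    HasExactlyNielsenClasses g (D - 1).natAbs := by
  choose z hz using hfix
  have hE : D - 1 ≠ 0 := by
    intro h
    have : D = 1 := by omega
    rw [this] at hD; norm_num at hD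
  have hgz : ∀ r, g (pr (z r)) = pr (z r) := fun r => by rw [← hlift, hz, pr_tr]
  have hinj : ∀ r < (D-1).natAbs, ∀ s < (D-1).natAbs, pr (z (r:ℕ)) = pr (z (s:ℕ)) → r = s := by
    intro r hr s hs h
    obtain ⟨j, hj⟩ := pr_eq h
    have h1 := hz s
    rw [hj, F_tr hFt, hz r, tr_tr, tr_tr] at h1
    have h2 := tr_inj h1
    exact small_arith (j := -j) hr hs (by linarith)
  classical
  refine ⟨(Finset.range (D-1).natAbs).image fun r : ℕ => pr (z r), ?_, ?_, ?_, ?_⟩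
  · rw [Finset.card_image_of_injOn, Finset.card_range]
    intro r hr s hs h
    exact hinj r (by simpa using hr) s (by simpa using hs) h
  · intro p hp
    obtain ⟨r, -, rfl⟩ := Finset.mem_image.1 hp
    exact hgz r
  · intro p hp q hq hpq hN
    obtain ⟨r, hr, rfl⟩ := Finset.mem_image.1 hp
    obtain ⟨s, hs, rfl⟩ := Finset.mem_image.1 hq
    obtain ⟨hg', h1, h2, γ, hγ⟩ := hN
    obtain ⟨Γ, hΓ, hΓ0⟩ := lift_exists γ.toContinuousMap (z r) γ.source.symm
    obtain ⟨j, hj⟩ := pr_eq (z := z s) (w := Γ 1) ((hΓ 1).trans γ.target).symm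
    have key := lift_end Γ
      ⟨fun t => tr (F (Γ t)) (-r), (tr_cont _).comp (hF.comp Γ.continuous)⟩
      (by simp only [ContinuousMap.coe_mk]; rw [hΓ0, hz, tr_tr, add_neg_cancel, tr_zero])
      (γ₀ := γ.toContinuousMap) (γ₁ := ((γ.map hg').cast h1.symm h2.symm).toContinuousMap)
      hΓ (fun t => by
        simp only [ContinuousMap.coe_mk]
        rw [pr_tr, hlift, hΓ]; rfl) hγ
    simp only [ContinuousMap.coe_mk] at key
    rw [hj, F_tr hFt, hz s, tr_tr, tr_tr] at key
    have h3 := tr_inj key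
    have := small_arith (j := j) (Finset.mem_range.1 hr) (Finset.mem_range.1 hs) (by linarith)
    subst this
    exact hpq rfl
  · intro p hp
    obtain ⟨w, rfl⟩ := pr_surj p
    obtain ⟨k, hk⟩ := pr_eq (z := w) (w := F w) (by rw [hlift, hp])
    have e1 := Int.emod_nonneg k hE
    have e2 := Int.emod_lt_abs k hE
    have e3 := Int.emod_add_mul_ediv k (D - 1)
    obtain ⟨r, hr⟩ := Int.eq_ofNat_of_zero_le e1
    have hw : F (tr w (-(k / (D-1)))) = tr (tr w (-(k / (D-1)))) r := by
      rw [F_tr hFt, hk, tr_tr, tr_tr, ← hr]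
      congr 1
      linarith
    refine ⟨pr (z r), Finset.mem_image.2 ⟨r, Finset.mem_range.2 ?_, rfl⟩, ?_⟩
    · rw [hr, Int.abs_eq_natAbs] at e2
      exact_mod_cast e2
    · generalize hu : tr w (-(k / (D-1))) = u at hw
      have hpu : pr w = pr u := by rw [← hu, pr_tr]
      rw [hpu] at hp ⊢
      let P : Path u (z r) := (PathConnectedSpace.joined u (z r)).somePath
      refine ⟨hg, hp, hgz r, P.map pr_cont, ?_⟩
      refine homotopic_of_lifts _ _ P.toContinuousMap
        ⟨fun t => tr (F (P t)) (-r), (tr_cont _).comp (hF.comp P.continuous)⟩ ?_ ?_ ?_ ?_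
      · change P 0 = tr (F (P 0)) (-r)
        rw [P.source, hw, tr_tr, add_neg_cancel, tr_zero]
      · change P 1 = tr (F (P 1)) (-r)
        rw [P.target, hz, tr_tr, add_neg_cancel, tr_zero]
      · intro t; rfl
      · intro t
        change pr (tr (F (P t)) (-r)) = g (pr (P t))
        rw [pr_tr, hlift]

/-- If `f` has an essential attracting set, then `f` is complete. -/
theorem stmt_16 (f : Ann → Ann) (d : ℤ) (hcov : IsCoveringMap f)
    (hdeg : HasDegree f d) (hd : 1 < |d|)
    (U : Set Ann) (hUopen : IsOpen U) (hUconn : IsConnected U)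
    (hUproper : U ≠ Set.univ) (hUclcomp : IsCompact (closure U))
    (hUess : ∃ (x : Ann) (γ : Path x x), Set.range γ ⊆ U ∧
      ¬ γ.Homotopic (Path.refl x))
    (hUattr : closure (f '' U) ⊆ U) :
    ∀ n : ℕ, 1 ≤ n →
      HasExactlyNielsenClasses (f^[n]) (d ^ n - 1).natAbs := by
  intro n hn
  obtain ⟨F, ⟨hF, hFl⟩, hFt⟩ := hdeg
  have hl : ∀ z, pr (F z) = f (pr z) := fun z => congrFun hFl z
  have hln : ∀ m z, pr (F^[m] z) = f^[m] (pr z) := by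
    intro m
    induction m with
    | zero => intro z; rfl
    | succ m ih =>
      intro z
      rw [Function.iterate_succ_apply', Function.iterate_succ_apply', hl, ih]
  have htn : ∀ m z, F^[m] (tr z 1) = tr (F^[m] z) (d ^ m) := by
    intro m
    induction m with
    | zero => intro z; simp
    | succ m ih =>
      intro z
      rw [Function.iterate_succ_apply', Function.iterate_succ_apply', ih, F_tr hFt, pow_succ]
  have hD : 1 < |d ^ n| := by
    rw [abs_pow]
    exact one_lt_pow₀ hd (by omega)
  have hfU : f '' U ⊆ U := subset_closure.trans hUattr
  have hmaps : ∀ m, ∀ p ∈ U, f^[m] p ∈ U := fun m p hp =>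
    (mapsTo_iff_image_subset.2 hfU).iterate m hp
  have hattr : closure (f^[n] '' U) ⊆ U := by
    refine (closure_mono ?_).trans hUattr
    rintro _ ⟨p, hp, rfl⟩
    obtain ⟨m, rfl⟩ : ∃ m, n = m + 1 := ⟨n - 1, by omega⟩
    rw [Function.iterate_succ_apply']
    exact ⟨_, hmaps m p hp, rfl⟩
  refine count_classes (hcov.continuous.iterate n) (hF.iterate n) (hln n) hD (htn n) fun r => ?_
  obtain ⟨z, hz⟩ := fixed_lift (g := f^[n]) (F := fun z => tr (F^[n] z) (-r))
    ((tr_cont _).comp (hF.iterate n)) (fun z => by rw [pr_tr, hln]) hD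
    (fun z => by rw [htn, tr_tr, tr_tr, add_comm]) hUopen hUconn hUclcomp hUess hattr
  refine ⟨z, ?_⟩
  have h1 := congrArg (fun u => tr u r) hz
  simpa only [tr_tr, neg_add_cancel, tr_zero] using h1
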